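/- Let p ∈ (0,1), t > 0 and y ≥ t. Writing K(x,w) = ( p²(w−x) + (1−p)²(w+x) )^{−3/2}, one has ( p²(1−p)/(2^{3/2} π) ) ∫_{−t}^{t} ∫_{|x|}^{t} K(x,w) (y − x)^{−3/2} dw dx = ( p/π ) · t^{1/2} / [ y ( p (y−t)^{1/2} + (1−p) (y+t)^{1/2} ) ]. Both sides equal the density w_t(y) of the jump-first Lévy walk limit Y(t) = L_{1/2}(S_{1/2}^{−1}(t)) at a point y ≥ t. -/

import Mathlib

open MeasureTheory Set

lemma aux_rpow (z : ℝ) (hz : 0 < z) : z ^ (-(3:ℝ)/2) = 1 / (√z)^3 := by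
  rw [Real.sqrt_eq_rpow, ← Real.rpow_natCast, ← Real.rpow_mul hz.le,
    neg_div, Real.rpow_neg hz.le, one_div]
  norm_num

lemma aux_inner (A C a t k : ℝ) (hA : 0 < A) (ha : 0 < A * a + C) (hat : a ≤ t) :
    ∫ w in a..t, (A * w + C) ^ (-(3:ℝ)/2) * k
      = (2 / A) * (1 / √(A * a + C) - 1 / √(A * t + C)) * k := by
  rw [intervalIntegral.integral_mul_const]
  congr 1
  have hpos : ∀ w ∈ uIcc a t, 0 < A * w + C := by
    intro w hw
    rw [uIcc_of_le hat] at hw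
    nlinarith [hw.1]
  have h := intervalIntegral.integral_eq_sub_of_hasDerivAt (a := a) (b := t)
    (f := fun w => -(2 / A) * (1 / √(A * w + C))) (f' := fun w => (A * w + C) ^ (-(3:ℝ)/2)) ?_ ?_
  · rw [h]; ring
  · intro w hw
    have hw' := hpos w hw
    rw [aux_rpow _ hw']
    have h1 : HasDerivAt (fun w => A * w + C) A w := by
      simpa using ((hasDerivAt_id w).const_mul A).add_const C
    have hs : 0 < √(A * w + C) := Real.sqrt_pos.2 hw'
    have h2 := (((hasDerivAt_const w (1:ℝ)).div (h1.sqrt hw'.ne') hs.ne').const_mul (-(2 / A)))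
    refine h2.congr_deriv ?_
    field_simp
    ring
  · apply ContinuousOn.intervalIntegrable
    apply ContinuousOn.rpow_const (by fun_prop)
    intro w hw
    exact Or.inl (hpos w hw).ne'

lemma aux_F2 (c B y t s x : ℝ) (hu : 0 < c + B * x) (hv : 0 < y - x) (hs : 0 ≤ s)
    (hyt : 0 < y + t) (hss : s^2 * (y + t) = c - B * t) :
    HasDerivAt (fun x => 2 * (x + t) / ((y + t) * (√(y - x) * (√(c + B * x) + s * √(y - x)))))
      (1 / √(c + B * x) * (1 / (√(y - x))^3)) x := by
  have h1 : HasDerivAt (fun x => c + B * x) B x := by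
    simpa using ((hasDerivAt_id x).const_mul B).const_add c
  have h2 : HasDerivAt (fun x => y - x) (-1) x := by
    simpa using (hasDerivAt_id x).const_sub y
  have hu' := h1.sqrt hu.ne'
  have hv' := h2.sqrt hv.ne'
  have hup := Real.sqrt_pos.2 hu
  have hvp := Real.sqrt_pos.2 hv
  have hu2 := Real.sq_sqrt hu.le
  have hv2 := Real.sq_sqrt hv.le
  have hn : HasDerivAt (fun x => 2 * (x + t)) 2 x := by
    simpa using ((hasDerivAt_id x).add_const t).const_mul 2
  have hsum : 0 < √(c + B * x) + s * √(y - x) := by positivity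
  have hd := ((hv'.mul (hu'.add (hv'.const_mul s))).const_mul (y + t))
  have h := hn.div hd (by simp only [Pi.mul_apply, Pi.add_apply]; positivity)
  refine h.congr_deriv ?_
  simp only [Pi.mul_apply, Pi.add_apply]
  clear h hd hu' hv' h1 h2 hn
  generalize √(c + B * x) = u at *
  generalize √(y - x) = v at *
  have hy : y = v^2 + x := by linarith
  have hc : c = u^2 - B * x := by linarith
  rw [hc, hy] at hss
  rw [hy] at hyt ⊢
  field_simp
  linear_combination (-v^2) * hss

lemma aux_pos (y x : ℝ) (hx : 0 < x) (hv : 0 < y - x) :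
    HasDerivAt (fun x => 2 / y * (√x / √(y - x))) (1 / √x * (1 / (√(y - x))^3)) x := by
  have h2 : HasDerivAt (fun x => y - x) (-1) x := by
    simpa using (hasDerivAt_id x).const_sub y
  have hv' := h2.sqrt hv.ne'
  have hup := Real.sqrt_pos.2 hx
  have hvp := Real.sqrt_pos.2 hv
  have hu2 := Real.sq_sqrt hx.le
  have hv2 := Real.sq_sqrt hv.le
  have h := (((hasDerivAt_id x).sqrt hx.ne').div hv' hvp.ne').const_mul (2 / y)
  refine h.congr_deriv ?_
  simp only [id]
  have hy : 0 < y := by linarith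
  field_simp
  rw [hu2, hv2]; ring

lemma aux_neg (y x : ℝ) (hx : x < 0) (hy : 0 < y) :
    HasDerivAt (fun x => -(2 / y * (√(-x) / √(y - x)))) (1 / √(-x) * (1 / (√(y - x))^3)) x := by
  have h2 : HasDerivAt (fun x => y - x) (-1) x := by
    simpa using (hasDerivAt_id x).const_sub y
  have hv : 0 < y - x := by linarith
  have hx' : 0 < -x := by linarith
  have hv' := h2.sqrt hv.ne'
  have hup := Real.sqrt_pos.2 hx'
  have hvp := Real.sqrt_pos.2 hv
  have hu2 := Real.sq_sqrt hx'.le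
  have hv2 := Real.sq_sqrt hv.le
  have h := (((hasDerivAt_neg x).sqrt hx'.ne').div hv' hvp.ne').const_mul (2 / y) |>.neg
  refine h.congr_deriv ?_
  field_simp
  rw [hu2, hv2]; ring

lemma aux_ftc (F g : ℝ → ℝ) (a b : ℝ) (hab : a ≤ b) (hc : ContinuousOn F (Icc a b))
    (hd : ∀ x ∈ Ioo a b, HasDerivAt F (g x) x) (hg : ∀ x ∈ Ioo a b, 0 ≤ g x) :
    IntervalIntegrable g volume a b ∧ ∫ x in a..b, g x = F b - F a := by
  have hi : IntervalIntegrable g volume a b := by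
    apply intervalIntegral.intervalIntegrable_deriv_of_nonneg (g := F)
    · rwa [uIcc_of_le hab]
    · rwa [min_eq_left hab, max_eq_right hab]
    · rwa [min_eq_left hab, max_eq_right hab]
  exact ⟨hi, intervalIntegral.integral_eq_sub_of_hasDerivAt_of_le hab hc hd hi⟩

/-- explicit inner integral -/
lemma aux_g (p q t y x : ℝ) (hp : 0 < p) (hq : 0 < q) (hx0 : x ≠ 0)
    (hxt : |x| ≤ t) (hv : 0 < y - x) :
    (∫ w in |x|..t, (p^2 * (w - x) + q^2 * (w + x)) ^ (-(3:ℝ)/2) * (y - x) ^ (-(3:ℝ)/2))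
    = (2 / (p^2 + q^2)) * (1 / √((p^2 + q^2) * |x| + (q^2 - p^2) * x)
        - 1 / √((p^2 + q^2) * t + (q^2 - p^2) * x)) * (1 / (√(y - x))^3)
    ∧ 0 < (p^2 + q^2) * |x| + (q^2 - p^2) * x
    ∧ 0 ≤ (∫ w in |x|..t, (p^2 * (w - x) + q^2 * (w + x)) ^ (-(3:ℝ)/2)
        * (y - x) ^ (-(3:ℝ)/2)) := by
  have hpos : 0 < (p^2 + q^2) * |x| + (q^2 - p^2) * x := by
    rcases lt_or_gt_of_ne hx0 with h | h
    · rw [abs_of_neg h]; nlinarith [mul_pos (pow_pos hp 2) (neg_pos.2 h)]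
    · rw [abs_of_pos h]; nlinarith [mul_pos (pow_pos hq 2) h]
  have hA : 0 < p^2 + q^2 := by positivity
  have key := aux_inner (p^2 + q^2) ((q^2 - p^2) * x) |x| t ((y - x) ^ (-(3:ℝ)/2)) hA hpos hxt
  have e : (∫ w in |x|..t, (p^2 * (w - x) + q^2 * (w + x)) ^ (-(3:ℝ)/2) * (y - x) ^ (-(3:ℝ)/2))
      = (2 / (p^2 + q^2)) * (1 / √((p^2 + q^2) * |x| + (q^2 - p^2) * x)
        - 1 / √((p^2 + q^2) * t + (q^2 - p^2) * x)) * (1 / (√(y - x))^3) := by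
    rw [← aux_rpow _ hv, ← key]
    congr 1
    ext w
    congr 2
    ring
  refine ⟨e, hpos, ?_⟩
  rw [e]
  have : 1 / √((p^2 + q^2) * t + (q^2 - p^2) * x)
      ≤ 1 / √((p^2 + q^2) * |x| + (q^2 - p^2) * x) := by
    apply one_div_le_one_div_of_le (Real.sqrt_pos.2 hpos)
    apply Real.sqrt_le_sqrt
    nlinarith
  have := sub_nonneg.2 this
  positivity

/-- the antiderivative of the second part -/
noncomputable def FF (p q t y x : ℝ) : ℝ :=
  2 * (x + t) / ((y + t) * (√(y - x) * (√((p^2 + q^2) * t + (q^2 - p^2) * x)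
    + (p * √(2 * t) / √(y + t)) * √(y - x))))

lemma aux_Apos (p q t x : ℝ) (hp : 0 < p) (hq : 0 < q) (ht : 0 < t) (h1 : -t ≤ x) (h2 : x ≤ t) :
    0 < (p^2 + q^2) * t + (q^2 - p^2) * x := by
  have hp2 := pow_pos hp 2
  have hq2 := pow_pos hq 2
  have e : (p^2 + q^2) * t + (q^2 - p^2) * x = p^2 * (t - x) + q^2 * (t + x) := by ring
  rw [e]
  rcases le_or_gt x 0 with h | h
  · have := mul_pos hp2 (by linarith : 0 < t - x)
    have := mul_nonneg hq2.le (by linarith : 0 ≤ t + x)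
    linarith
  · have := mul_pos hq2 (by linarith : 0 < t + x)
    have := mul_nonneg hp2.le (by linarith : 0 ≤ t - x)
    linarith

lemma FF_deriv (p q t y x : ℝ) (hp : 0 < p) (hq : 0 < q) (ht : 0 < t) (hy : t ≤ y)
    (h1 : -t ≤ x) (h2 : x ≤ t) (hv : x < y) :
    HasDerivAt (FF p q t y) (1 / √((p^2 + q^2) * t + (q^2 - p^2) * x) * (1 / (√(y - x))^3)) x := by
  apply aux_F2 _ _ _ _ _ _ (aux_Apos p q t x hp hq ht h1 h2) (by linarith) (by positivity)
    (by linarith)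
  have : 0 < y + t := by linarith
  rw [div_pow, mul_pow, Real.sq_sqrt (by positivity), Real.sq_sqrt this.le]
  field_simp
  ring

lemma piece_neg (p q t y : ℝ) (hp : 0 < p) (hq : 0 < q) (ht : 0 < t) (hy : t ≤ y) :
    IntervalIntegrable (fun x => ∫ w in |x|..t,
      (p^2 * (w - x) + q^2 * (w + x)) ^ (-(3:ℝ)/2) * (y - x) ^ (-(3:ℝ)/2)) volume (-t) 0 ∧
    (∫ x in (-t)..0, ∫ w in |x|..t,
      (p^2 * (w - x) + q^2 * (w + x)) ^ (-(3:ℝ)/2) * (y - x) ^ (-(3:ℝ)/2))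
    = (2 / (p^2 + q^2)) * (1 / (p * √2) * (2 / y * (√t / √(y + t))) - FF p q t y 0) := by
  have h := aux_ftc (fun x => (2 / (p^2 + q^2)) *
    (1 / (p * √2) * (-(2 / y * (√(-x) / √(y - x)))) - FF p q t y x)) (fun x => ∫ w in |x|..t,
      (p^2 * (w - x) + q^2 * (w + x)) ^ (-(3:ℝ)/2) * (y - x) ^ (-(3:ℝ)/2)) (-t) 0 (by linarith)
      ?_ ?_ ?_
  · refine ⟨h.1, h.2.trans ?_⟩
    simp [FF]
    ring
  · apply ContinuousOn.mul continuousOn_const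
    apply ContinuousOn.sub
    · apply ContinuousOn.mul continuousOn_const
      apply ContinuousOn.neg
      apply ContinuousOn.mul continuousOn_const
      apply ContinuousOn.div (by fun_prop) (by fun_prop)
      intro x hx
      exact (Real.sqrt_pos.2 (by linarith [hx.2])).ne'
    · intro x hx
      exact (FF_deriv p q t y x hp hq ht hy hx.1 (by linarith [hx.2])
        (by linarith [hx.2])).continuousAt.continuousWithinAt
  · intro x hx
    have hx2 := hx.2
    have hx1 := hx.1
    obtain ⟨e, _, _⟩ := aux_g p q t y x hp hq hx2.ne (by rw [abs_of_neg hx2]; linarith)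
      (by linarith)
    rw [e]
    refine ((((aux_neg y x hx2 (by linarith)).const_mul (1 / (p * √2))).sub
      (FF_deriv p q t y x hp hq ht hy hx1.le (by linarith) (by linarith))).const_mul
        (2 / (p^2 + q^2))).congr_deriv ?_
    have : √((p^2 + q^2) * |x| + (q^2 - p^2) * x) = p * √2 * √(-x) := by
      rw [abs_of_neg hx2, show (p^2 + q^2) * -x + (q^2 - p^2) * x = p^2 * (2 * -x) by ring,
        Real.sqrt_mul (by positivity), Real.sqrt_sq hp.le, Real.sqrt_mul (by norm_num)]
      ring
    rw [this]
    simp only [one_div, mul_inv]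
    ring
  · intro x hx
    exact (aux_g p q t y x hp hq hx.2.ne (by rw [abs_of_neg hx.2]; linarith [hx.1])
      (by linarith [hx.2])).2.2

lemma sqrt_x (p q x : ℝ) (hq : 0 < q) (hx : 0 < x) :
    √((p^2 + q^2) * |x| + (q^2 - p^2) * x) = q * √2 * √x := by
  rw [abs_of_pos hx, show (p^2 + q^2) * x + (q^2 - p^2) * x = q^2 * (2 * x) by ring,
    Real.sqrt_mul (by positivity), Real.sqrt_sq hq.le, Real.sqrt_mul (by norm_num)]
  ring

lemma piece_pos (p q t y : ℝ) (hp : 0 < p) (hq : 0 < q) (ht : 0 < t) (hy : t < y) :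
    IntervalIntegrable (fun x => ∫ w in |x|..t,
      (p^2 * (w - x) + q^2 * (w + x)) ^ (-(3:ℝ)/2) * (y - x) ^ (-(3:ℝ)/2)) volume 0 t ∧
    (∫ x in 0..t, ∫ w in |x|..t,
      (p^2 * (w - x) + q^2 * (w + x)) ^ (-(3:ℝ)/2) * (y - x) ^ (-(3:ℝ)/2))
    = (2 / (p^2 + q^2)) * (1 / (q * √2) * (2 / y * (√t / √(y - t)))
      - FF p q t y t + FF p q t y 0) := by
  have h := aux_ftc (fun x => (2 / (p^2 + q^2)) *
    (1 / (q * √2) * ((2 / y * (√x / √(y - x)))) - FF p q t y x)) (fun x => ∫ w in |x|..t,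
      (p^2 * (w - x) + q^2 * (w + x)) ^ (-(3:ℝ)/2) * (y - x) ^ (-(3:ℝ)/2)) 0 t (by linarith)
      ?_ ?_ ?_
  · refine ⟨h.1, h.2.trans ?_⟩
    simp
    ring
  · apply ContinuousOn.mul continuousOn_const
    apply ContinuousOn.sub
    · apply ContinuousOn.mul continuousOn_const
      apply ContinuousOn.mul continuousOn_const
      apply ContinuousOn.div (by fun_prop) (by fun_prop)
      intro x hx
      exact (Real.sqrt_pos.2 (by linarith [hx.2])).ne'
    · intro x hx
      exact (FF_deriv p q t y x hp hq ht hy.le (by linarith [hx.1]) (by linarith [hx.2])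
        (by linarith [hx.2])).continuousAt.continuousWithinAt
  · intro x hx
    have hx2 := hx.2
    have hx1 := hx.1
    obtain ⟨e, _, _⟩ := aux_g p q t y x hp hq hx1.ne' (by rw [abs_of_pos hx1]; linarith)
      (by linarith)
    rw [e]
    refine ((((aux_pos y x hx1 (by linarith)).const_mul (1 / (q * √2))).sub
      (FF_deriv p q t y x hp hq ht hy.le (by linarith) (by linarith) (by linarith))).const_mul
        (2 / (p^2 + q^2))).congr_deriv ?_
    rw [sqrt_x p q x hq hx1]
    simp only [one_div, mul_inv]
    ring
  · intro x hx
    exact (aux_g p q t y x hp hq hx.1.ne' (by rw [abs_of_pos hx.1]; linarith [hx.2])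
      (by linarith [hx.2])).2.2

lemma aux_F3 (c B y x : ℝ) (hu : 0 < c + B * x) (hv : 0 < y - x) (hD : c + B * y ≠ 0) :
    HasDerivAt (fun x => 2 / (c + B * y) * (√(c + B * x) / √(y - x)))
      (1 / √(c + B * x) * (1 / (√(y - x))^3)) x := by
  have h1 : HasDerivAt (fun x => c + B * x) B x := by
    simpa using ((hasDerivAt_id x).const_mul B).const_add c
  have h2 : HasDerivAt (fun x => y - x) (-1) x := by
    simpa using (hasDerivAt_id x).const_sub y
  have hvp := Real.sqrt_pos.2 hv
  have hup := Real.sqrt_pos.2 hu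
  have hu2 := Real.sq_sqrt hu.le
  have hv2 := Real.sq_sqrt hv.le
  have h := ((h1.sqrt hu.ne').div (h2.sqrt hv.ne') hvp.ne').const_mul (2 / (c + B * y))
  refine h.congr_deriv ?_
  field_simp
  rw [hu2, hv2]; ring

lemma piece_eq (p q t : ℝ) (hp : 0 < p) (hq : 0 < q) (ht : 0 < t) :
    IntervalIntegrable (fun x => ∫ w in |x|..t,
      (p^2 * (w - x) + q^2 * (w + x)) ^ (-(3:ℝ)/2) * (t - x) ^ (-(3:ℝ)/2)) volume 0 t ∧
    (∫ x in 0..t, ∫ w in |x|..t,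
      (p^2 * (w - x) + q^2 * (w + x)) ^ (-(3:ℝ)/2) * (t - x) ^ (-(3:ℝ)/2))
    = (2 / (p^2 + q^2)) * (√(p^2 + q^2) / (q^2 * t)) := by
  have hA : 0 < p^2 + q^2 := by positivity
  have hden : ∀ x, 0 ≤ x → x ≤ t →
      0 < q * √2 * √x + √((p^2 + q^2) * t + (q^2 - p^2) * x) := by
    intro x h0 h1
    have := Real.sqrt_pos.2 (aux_Apos p q t x hp hq ht (by linarith) h1)
    positivity
  have h := aux_ftc (fun x => (2 / (p^2 + q^2)) *
    (-((p^2 + q^2) / (q^2 * t) * (√(t - x) /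
      (q * √2 * √x + √((p^2 + q^2) * t + (q^2 - p^2) * x)))))) (fun x => ∫ w in |x|..t,
      (p^2 * (w - x) + q^2 * (w + x)) ^ (-(3:ℝ)/2) * (t - x) ^ (-(3:ℝ)/2)) 0 t (by linarith)
      ?_ ?_ ?_
  · refine ⟨h.1, h.2.trans ?_⟩
    have h2 := Real.sqrt_pos.2 hA
    have h3 := Real.sqrt_pos.2 ht
    simp only [sub_self, Real.sqrt_zero, mul_zero, add_zero, zero_add, sub_zero, zero_div, neg_zero]
    rw [Real.sqrt_mul hA.le]
    field_simp
    rw [Real.sq_sqrt hA.le]; ring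
  · apply ContinuousOn.mul continuousOn_const
    apply ContinuousOn.neg
    apply ContinuousOn.mul continuousOn_const
    apply ContinuousOn.div (by fun_prop) (by fun_prop)
    intro x hx
    exact (hden x hx.1 hx.2).ne'
  · intro x hx
    have hx2 := hx.2
    have hx1 := hx.1
    obtain ⟨e, _, _⟩ := aux_g p q t t x hp hq hx1.ne' (by rw [abs_of_pos hx1]; linarith)
      (by linarith)
    rw [e]
    have hD : (p^2 + q^2) * t + (q^2 - p^2) * t = 2 * q^2 * t := by ring
    have key := (((aux_pos t x hx1 (by linarith)).const_mul (1 / (q * √2))).sub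
      (aux_F3 ((p^2 + q^2) * t) (q^2 - p^2) t x
        (aux_Apos p q t x hp hq ht (by linarith) hx2.le) (by linarith)
        (by rw [hD]; positivity))).const_mul (2 / (p^2 + q^2))
    have key2 := key.congr_of_eventuallyEq (f₁ := fun x => (2 / (p^2 + q^2)) *
    (-((p^2 + q^2) / (q^2 * t) * (√(t - x) /
      (q * √2 * √x + √((p^2 + q^2) * t + (q^2 - p^2) * x)))))) ?_
    · refine key2.congr_deriv ?_
      rw [sqrt_x p q x hq hx1]
      simp only [one_div, mul_inv]
      ring
    · filter_upwards [Ioo_mem_nhds hx1 hx2] with z hz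
      have hd := hden z hz.1.le hz.2.le
      have hvz : 0 < t - z := by linarith [hz.2]
      have hv2 := Real.sq_sqrt hvz.le
      have hvp := Real.sqrt_pos.2 hvz
      have hu2 := Real.sq_sqrt (aux_Apos p q t z hp hq ht (by linarith [hz.1]) hz.2.le).le
      have hz2 := Real.sq_sqrt hz.1.le
      have h22 := Real.sq_sqrt (show (0:ℝ) ≤ 2 by norm_num)
      have h2p := Real.sqrt_pos.2 (show (0:ℝ) < 2 by norm_num)
      simp only [Pi.sub_apply]
      rw [hD]
      set u := √((p^2 + q^2) * t + (q^2 - p^2) * z)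
      set v := √(t - z)
      set w := √z
      set r := √2
      clear_value u v w r
      congr 1
      have e1 : 1 / (q * r) * (2 / t * (w / v)) = q * r * w / (q^2 * t * v) := by
        field_simp
        rw [h22]
      have e2 : 2 / (2 * q^2 * t) * (u / v) = u / (q^2 * t * v) := by
        field_simp
      rw [e1, e2]
      field_simp
      rw [hv2]
      have : (q * r * w + u) * (q * r * w - u) = -(p^2 + q^2) * (t - z) := by
        linear_combination q^2 * w^2 * h22 + 2 * q^2 * hz2 - hu2
      linarith
  · intro x hx
    exact (aux_g p q t t x hp hq hx.1.ne' (by rw [abs_of_pos hx.1]; linarith [hx.2])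
      (by linarith [hx.2])).2.2

lemma main_total (p q t y : ℝ) (hp : 0 < p) (hq : 0 < q) (ht : 0 < t) (hy : t ≤ y) :
    (∫ x in (-t)..t, ∫ w in |x|..t,
      (p^2 * (w - x) + q^2 * (w + x)) ^ (-(3:ℝ)/2) * (y - x) ^ (-(3:ℝ)/2))
    = 2 * √2 * √t / (p * q * y * (p * √(y - t) + q * √(y + t))) := by
  obtain ⟨i1, e1⟩ := piece_neg p q t y hp hq ht hy
  have hA : 0 < p^2 + q^2 := by positivity
  have h22 := Real.sq_sqrt (show (0:ℝ) ≤ 2 by norm_num)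
  have h2p := Real.sqrt_pos.2 (show (0:ℝ) < 2 by norm_num)
  have htp := Real.sqrt_pos.2 ht
  have ht2 := Real.sq_sqrt ht.le
  rcases hy.eq_or_lt with rfl | hlt
  · obtain ⟨i2, e2⟩ := piece_eq p q t hp hq ht
    rw [← intervalIntegral.integral_add_adjacent_intervals i1 i2, e1, e2]
    have hFF : FF p q t t 0 = (√(p^2 + q^2) - p) / (q^2 * t) := by
      unfold FF
      have hAp := Real.sqrt_pos.2 hA
      have hA2 := Real.sq_sqrt hA.le
      have : p * √(2 * t) / √(t + t) = p := by
        rw [← two_mul]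
        field_simp
      rw [this]
      simp only [sub_zero, mul_zero, add_zero, zero_add]
      rw [Real.sqrt_mul hA.le]
      have hs : 0 < √(p^2 + q^2) + p := by positivity
      rw [show √t * (√(p^2 + q^2) * √t + p * √t) = t * (√(p^2 + q^2) + p) by
        linear_combination (√(p^2 + q^2) + p) * ht2]
      field_simp
      linear_combination -2 * hA2
    rw [hFF]
    have : √(t + t) = √2 * √t := by rw [← two_mul, Real.sqrt_mul (by norm_num)]
    rw [this]
    simp only [sub_self, Real.sqrt_zero, mul_zero, zero_add]
    field_simp
    rw [h22]
    ring
  · obtain ⟨i2, e2⟩ := piece_pos p q t y hp hq ht hlt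
    rw [← intervalIntegral.integral_add_adjacent_intervals i1 i2, e1, e2]
    have ha : 0 < y - t := by linarith
    have hb : 0 < y + t := by linarith
    have hy0 : 0 < y := by linarith
    have hap := Real.sqrt_pos.2 ha
    have hbp := Real.sqrt_pos.2 hb
    have ha2 := Real.sq_sqrt ha.le
    have hb2 := Real.sq_sqrt hb.le
    have hFF : FF p q t y t = 2 * √2 * √t / (√(y - t) * √(y + t) *
        (p * √(y - t) + q * √(y + t))) := by
      unfold FF
      rw [show (p^2 + q^2) * t + (q^2 - p^2) * t = q^2 * (2 * t) by ring,
        Real.sqrt_mul (by positivity), Real.sqrt_sq hq.le, Real.sqrt_mul (by norm_num)]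
      set a := √(y - t)
      set b := √(y + t)
      set m := √t
      set r := √2
      rw [← hb2, ← ht2]
      clear_value a b m r
      field_simp
      rw [h22]
      ring
    rw [hFF]
    set a := √(y - t)
    set b := √(y + t)
    set m := √t
    set r := √2
    have hyy : y = (a^2 + b^2) / 2 := by linarith
    clear_value a b m r
    clear e1 e2 i1 i2 hFF
    have hab : a^2 + b^2 = 2 * y := by linarith
    field_simp
    rw [h22]
    linear_combination 2 * q * m * p * hab

theorem jump_first_density_half_right (p t y : ℝ) (hp : p ∈ Ioo (0:ℝ) 1) (ht : 0 < t)
    (hy : t ≤ y) :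
    (p^2 * (1 - p) / (2 ^ ((3:ℝ)/2) * Real.pi)) *
        (∫ x in (-t)..t, ∫ w in |x|..t,
          (p^2 * (w - x) + (1 - p)^2 * (w + x)) ^ (-(3:ℝ)/2) * (y - x) ^ (-(3:ℝ)/2))
      = (p / Real.pi) * t ^ ((1:ℝ)/2) /
          (y * (p * (y - t) ^ ((1:ℝ)/2) + (1 - p) * (y + t) ^ ((1:ℝ)/2))) := by
  have hp0 := hp.1
  have hq : 0 < 1 - p := by linarith [hp.2]
  rw [main_total p (1 - p) t y hp0 hq ht hy]
  simp only [← Real.sqrt_eq_rpow]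
  have h2 : (2:ℝ) ^ ((3:ℝ)/2) = 2 * √2 := by
    rw [show (3:ℝ)/2 = 1 + 1/2 by norm_num, Real.rpow_add (by norm_num), Real.rpow_one,
      Real.sqrt_eq_rpow]
  rw [h2]
  have h2p := Real.sqrt_pos.2 (show (0:ℝ) < 2 by norm_num)
  have hy0 : 0 < y := by linarith
  have hbp := Real.sqrt_pos.2 (show 0 < y + t by linarith)
  have hs : 0 < p * √(y - t) + (1 - p) * √(y + t) := by positivity
  have := Real.pi_pos
  generalize 1 - p = q at *
  field_simp
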